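/- Rigidity of simple magic angles (first implication of the Rigidity Theorem): Let U be a tunnelling potential which additionally satisfies conj(U(conj z)) = −U(−z) for all z ∈ ℂ, and consider the chiral model D(α) built from U. If α ∈ ℂ is a simple magic parameter, i.e. dim_ℂ Ker(α,k) = 1 for every k ∈ ℂ (flat band of multiplicity two), then dim_ℂ Ker₂(α) = 1. -/

import Mathlib

noncomputable section

open Complex MeasureTheory

namespace TBG

/-- `ω = exp(2πi/3)`. -/
def ω : ℂ := Complex.exp (2 * Real.pi * Complex.I / 3)

/-- The moiré lattice `Λ = ℤω + ℤ ⊂ ℂ`. -/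
def Λ : Set ℂ := {z : ℂ | ∃ m n : ℤ, z = m * ω + n}

/-- The dual lattice `Λ* = (4πi/√3)·Λ`. -/
def Λdual : Set ℂ := {p : ℂ | ∃ m n : ℤ, p = 4 * Real.pi * Complex.I / Real.sqrt 3 * (m * ω + n)}

/-- The high symmetry point `K = 4π/3`. -/
def K : ℂ := 4 * Real.pi / 3

/-- `⟨z,w⟩ = Re (z · conj w)`. -/
def pair (z w : ℂ) : ℝ := (z * (starRingEnd ℂ) w).re

/-- `2 D_z̄ f = (1/i)(∂_x f + i ∂_y f)`. -/
def Dbar (f : ℂ → ℂ) (z : ℂ) : ℂ :=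
  1 / Complex.I * (fderiv ℝ f z 1 + Complex.I * fderiv ℝ f z Complex.I)

/-- A tunnelling potential: smooth, with the translational and rotational symmetries. -/
def IsTunnelling (U : ℂ → ℂ) : Prop :=
  ContDiff ℝ (⊤ : ℕ∞) U ∧
    (∀ γ ∈ Λ, ∀ z : ℂ, U (z + γ) = Complex.exp (Complex.I * (pair γ K : ℂ)) * U z) ∧
    ∀ z : ℂ, U (ω * z) = ω * U z

/-- Membership in `ker_{L²₀}(D(α)+k)` for the chiral model with tunnelling
potentials `U₊ = Up`, `U₋ = Um`: smooth solutions of `(D(α)+k)u = 0` with the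
Floquet boundary conditions. -/
def InKer (Up Um : ℂ → ℂ) (α k : ℂ) (u : ℂ → ℂ × ℂ) : Prop :=
  ContDiff ℝ (⊤ : ℕ∞) u ∧
    (∀ z : ℂ, Dbar (fun w => (u w).1) z + k * (u z).1 + α * Up z * (u z).2 = 0) ∧
    (∀ z : ℂ, Dbar (fun w => (u w).2) z + k * (u z).2 + α * Um z * (u z).1 = 0) ∧
    (∀ γ ∈ Λ, ∀ z : ℂ, (u (z + γ)).1 = Complex.exp (-Complex.I * (pair γ K : ℂ)) * (u z).1) ∧
    (∀ γ ∈ Λ, ∀ z : ℂ, (u (z + γ)).2 = Complex.exp (Complex.I * (pair γ K : ℂ)) * (u z).2)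

/-- `Ker(α,k)` as a set of functions. -/
def kerSet (Up Um : ℂ → ℂ) (α k : ℂ) : Set (ℂ → ℂ × ℂ) := {u | InKer Up Um α k u}

/-- `dim_ℂ Ker(α,k)` (the set `Ker(α,k)` is a linear subspace, so the finrank of its span
is its dimension). -/
def kerDim (Up Um : ℂ → ℂ) (α k : ℂ) : ℕ :=
  Module.finrank ℂ ↥(Submodule.span ℂ (kerSet Up Um α k))

/-- `Ker_p(α) = {u ∈ Ker(α,0) : u(ωz) = ω^(−p)·u(z)}`. -/
def kerPSet (Up Um : ℂ → ℂ) (α : ℂ) (p : ℕ) : Set (ℂ → ℂ × ℂ) :=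
  {u | u ∈ kerSet Up Um α 0 ∧ ∀ z : ℂ, u (ω * z) = (ω ^ (-(p : ℤ))) • u z}

/-- `dim_ℂ Ker_p(α)`. -/
def kerPDim (Up Um : ℂ → ℂ) (α : ℂ) (p : ℕ) : ℕ :=
  Module.finrank ℂ ↥(Submodule.span ℂ (kerPSet Up Um α p))

/-- `α` is magic: the flat band condition `Ker(α,k) ≠ {0}` for every `k`. -/
def IsMagic (Up Um : ℂ → ℂ) (α : ℂ) : Prop :=
  ∀ k : ℂ, ∃ u ∈ kerSet Up Um α k, u ≠ 0

open Filter Topology Function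

open scoped ComplexConjugate

section DbarCalculus

open scoped ContDiff

lemma Dbar_congr {f g : ℂ → ℂ} {z : ℂ} (h : f =ᶠ[𝓝 z] g) : Dbar f z = Dbar g z := by
  simp only [Dbar, h.fderiv_eq]

lemma Dbar_add {f g : ℂ → ℂ} {z : ℂ} (hf : DifferentiableAt ℝ f z) (hg : DifferentiableAt ℝ g z) :
    Dbar (fun w => f w + g w) z = Dbar f z + Dbar g z := by
  have : fderiv ℝ (fun w => f w + g w) z = fderiv ℝ f z + fderiv ℝ g z := fderiv_add hf hg
  simp only [Dbar, this, add_apply]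
  ring

lemma Dbar_mul {f g : ℂ → ℂ} {z : ℂ} (hf : DifferentiableAt ℝ f z) (hg : DifferentiableAt ℝ g z) :
    Dbar (fun w => f w * g w) z = Dbar f z * g z + f z * Dbar g z := by
  have : fderiv ℝ (fun w => f w * g w) z = f z • fderiv ℝ g z + g z • fderiv ℝ f z :=
    fderiv_mul hf hg
  simp only [Dbar, this, add_apply, smul_apply, smul_eq_mul]
  ring

lemma Dbar_of_differentiableAt {f : ℂ → ℂ} {z : ℂ} (hf : DifferentiableAt ℂ f z) :
    Dbar f z = 0 := by
  have h : fderiv ℝ f z = (fderiv ℂ f z).restrictScalars ℝ :=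
    (hf.hasFDerivAt.restrictScalars ℝ).fderiv
  have h2 : fderiv ℂ f z I = I * fderiv ℂ f z 1 := by
    simp [← smul_eq_mul]
  simp only [Dbar, h, ContinuousLinearMap.coe_restrictScalars', h2]
  rw [← mul_assoc, I_mul_I]
  ring

lemma contDiff_Dbar {f : ℂ → ℂ} (hf : ContDiff ℝ ∞ f) : ContDiff ℝ ∞ (Dbar f) := by
  have h := (contDiff_infty_iff_fderiv.1 hf).2
  unfold Dbar
  exact contDiff_const.mul ((h.clm_apply contDiff_const).add
    (contDiff_const.mul (h.clm_apply contDiff_const)))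

lemma contDiff_iterate_Dbar {f : ℂ → ℂ} (hf : ContDiff ℝ ∞ f) (k : ℕ) :
    ContDiff ℝ ∞ (Dbar^[k] f) := by
  induction k with
  | zero => exact hf
  | succ k ih => rw [iterate_succ_apply']; exact contDiff_Dbar ih

lemma smooth_differentiableAt {f : ℂ → ℂ} (hf : ContDiff ℝ ∞ f) (z : ℂ) :
    DifferentiableAt ℝ f z :=
  hf.differentiable (by simp) z

lemma contDiff_conj_sub (z₀ : ℂ) : ContDiff ℝ ∞ (fun z : ℂ => conj (z - z₀)) :=
  conjCLE.contDiff.comp (contDiff_id.sub contDiff_const)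

lemma Dbar_conj_sub (z₀ z : ℂ) : Dbar (fun z : ℂ => conj (z - z₀)) z = -2 * I := by
  have h : HasFDerivAt (fun z : ℂ => conj (z - z₀)) (conjCLE : ℂ →L[ℝ] ℂ) z :=
    (conjCLE : ℂ →L[ℝ] ℂ).hasFDerivAt.comp z ((hasFDerivAt_id z).sub_const z₀)
  simp only [Dbar, h.fderiv]
  simp
  ring

lemma Dbar_sub_const (z₀ z : ℂ) : Dbar (fun z : ℂ => z - z₀) z = 0 :=
  Dbar_of_differentiableAt (by fun_prop)

lemma iterate_Dbar_add {f g : ℂ → ℂ} (hf : ContDiff ℝ ∞ f) (hg : ContDiff ℝ ∞ g) (k : ℕ) :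
    Dbar^[k] (fun z => f z + g z) = fun z => Dbar^[k] f z + Dbar^[k] g z := by
  induction k with
  | zero => rfl
  | succ k ih =>
    funext z
    rw [iterate_succ_apply', ih, iterate_succ_apply', iterate_succ_apply',
      Dbar_add (smooth_differentiableAt (contDiff_iterate_Dbar hf k) z)
        (smooth_differentiableAt (contDiff_iterate_Dbar hg k) z)]

lemma iterate_Dbar_sub_mul {a : ℂ → ℂ} (ha : ContDiff ℝ ∞ a) (z₀ : ℂ) (k : ℕ) :
    Dbar^[k] (fun z => (z - z₀) * a z) = fun z => (z - z₀) * Dbar^[k] a z := by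
  induction k with
  | zero => rfl
  | succ k ih =>
    funext z
    rw [iterate_succ_apply', ih, iterate_succ_apply',
      Dbar_mul (by fun_prop) (smooth_differentiableAt (contDiff_iterate_Dbar ha k) z),
      Dbar_sub_const]
    ring

lemma iterate_Dbar_conj_sub_mul {b : ℂ → ℂ} (hb : ContDiff ℝ ∞ b) (z₀ : ℂ) (k : ℕ) :
    Dbar^[k + 1] (fun z => conj (z - z₀) * b z) =
      fun z => conj (z - z₀) * Dbar^[k + 1] b z + (k + 1) * (-2 * I) * Dbar^[k] b z := by
  induction k with
  | zero =>
    funext z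
    simp only [zero_add, iterate_one, iterate_zero, id]
    rw [Dbar_mul (smooth_differentiableAt (contDiff_conj_sub z₀) z) (smooth_differentiableAt hb z),
      Dbar_conj_sub]
    push_cast
    ring
  | succ k ih =>
    funext z
    have h1 := contDiff_iterate_Dbar hb (k + 1)
    have h0 := contDiff_iterate_Dbar hb k
    rw [iterate_succ_apply', ih, Dbar_add
      (smooth_differentiableAt ((contDiff_conj_sub z₀).mul h1) z)
      (smooth_differentiableAt (contDiff_const.mul h0) z),
      Dbar_mul (smooth_differentiableAt (contDiff_conj_sub z₀) z) (smooth_differentiableAt h1 z),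
      Dbar_mul (by fun_prop) (smooth_differentiableAt h0 z), Dbar_conj_sub,
      Dbar_of_differentiableAt (f := fun _ => ((k : ℂ) + 1) * (-2 * I)) (by fun_prop),
      iterate_succ_apply' Dbar (k + 1), iterate_succ_apply' Dbar k]
    push_cast
    ring

end DbarCalculus

section Hadamard

open scoped ContDiff

lemma contDiff_radial_integral (n : ℕ) (z₀ : ℂ) : ∀ (F : Type) [NormedAddCommGroup F]
    [NormedSpace ℝ F] (g : ℂ → F) (_ : ContDiff ℝ ∞ g) (m : ℕ),
    ContDiff ℝ n (fun z => ∫ t in (0 : ℝ)..1, t ^ m • g (z₀ + t • (z - z₀))) := by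
  have key : ∀ (F : Type) [NormedAddCommGroup F] [NormedSpace ℝ F] (g : ℂ → F)
      (_ : ContDiff ℝ ∞ g) (m : ℕ) (z : ℂ),
      HasFDerivAt (fun z => ∫ t in (0 : ℝ)..1, t ^ m • g (z₀ + t • (z - z₀)))
        (∫ t in (0 : ℝ)..1, t ^ (m + 1) • fderiv ℝ g (z₀ + t • (z - z₀))) z := by
    intro F _ _ g hg m x
    have hg' := (contDiff_infty_iff_fderiv.1 hg).2.continuous
    have hgc := hg.continuous
    have hcont : Continuous (fun p : ℂ × ℝ =>
        p.2 ^ (m + 1) • fderiv ℝ g (z₀ + p.2 • (p.1 - z₀))) := by fun_prop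
    obtain ⟨C, hC⟩ := ((isCompact_closedBall x 1).prod (isCompact_Icc (a := (0 : ℝ)) (b := 1))
      ).exists_bound_of_continuousOn hcont.continuousOn
    refine intervalIntegral.hasFDerivAt_integral_of_dominated_of_fderiv_le
      (F := fun z t => t ^ m • g (z₀ + t • (z - z₀)))
      (F' := fun z t => t ^ (m + 1) • fderiv ℝ g (z₀ + t • (z - z₀)))
      (bound := fun _ => C) (s := Metric.closedBall x 1)
      (Metric.closedBall_mem_nhds x one_pos) ?_ ?_ ?_ ?_ ?_ ?_
    · exact .of_forall fun z => Continuous.aestronglyMeasurable (by fun_prop)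
    · exact Continuous.intervalIntegrable (by fun_prop) _ _
    · exact Continuous.aestronglyMeasurable (by fun_prop)
    · refine .of_forall fun t ht z hz => hC (z, t) ⟨hz, ?_⟩
      rw [Set.uIoc_of_le zero_le_one] at ht
      exact ⟨ht.1.le, ht.2⟩
    · simp
    · refine .of_forall fun t _ z _ => ?_
      have h1 : HasFDerivAt (fun z : ℂ => z₀ + t • (z - z₀)) (t • ContinuousLinearMap.id ℝ ℂ) z :=
        (((hasFDerivAt_id z).sub_const z₀).const_smul t).const_add z₀
      have h2 := ((hg.differentiable (by simp) (z₀ + t • (z - z₀))).hasFDerivAt.comp z h1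
        ).const_smul (t ^ m)
      refine h2.congr_fderiv ?_
      ext
      simp [pow_succ, mul_smul]
  induction n with
  | zero =>
    intro F _ _ g hg m
    exact contDiff_zero.2 (continuous_iff_continuousAt.2 fun z => (key F g hg m z).continuousAt)
  | succ n ih =>
    intro F _ _ g hg m
    push_cast
    rw [contDiff_succ_iff_fderiv]
    refine ⟨fun z => (key F g hg m z).differentiableAt, by simp, ?_⟩
    rw [show fderiv ℝ (fun z => ∫ t in (0 : ℝ)..1, t ^ m • g (z₀ + t • (z - z₀))) = _ from
      funext fun z => (key F g hg m z).fderiv]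
    exact ih _ _ (contDiff_infty_iff_fderiv.1 hg).2 (m + 1)

/-- Hadamard's lemma in the variables `z - z₀` and `conj (z - z₀)`. -/
lemma exists_hadamard {f : ℂ → ℂ} (hf : ContDiff ℝ ∞ f) (z₀ : ℂ) :
    ∃ a b : ℂ → ℂ, ContDiff ℝ ∞ a ∧ ContDiff ℝ ∞ b ∧
      ∀ z, f z = f z₀ + (z - z₀) * a z + conj (z - z₀) * b z := by
  have hd := (contDiff_infty_iff_fderiv.1 hf).2
  set Φ : ℂ → (ℂ →L[ℝ] ℂ) := fun z => ∫ t in (0 : ℝ)..1, t ^ 0 • fderiv ℝ f (z₀ + t • (z - z₀))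
    with hΦ
  have hΦs : ContDiff ℝ ∞ Φ := contDiff_infty.2 fun n => contDiff_radial_integral n z₀ _ _ hd 0
  have h1 : ContDiff ℝ ∞ fun z => Φ z 1 := hΦs.clm_apply contDiff_const
  have hI : ContDiff ℝ ∞ fun z => Φ z I := hΦs.clm_apply contDiff_const
  refine ⟨fun z => (Φ z 1 - I * Φ z I) / 2, fun z => (Φ z 1 + I * Φ z I) / 2,
    (h1.sub (contDiff_const.mul hI)).div_const 2, (h1.add (contDiff_const.mul hI)).div_const 2,
    fun z => ?_⟩
  have hmain : f z - f z₀ = Φ z (z - z₀) := by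
    have hder : ∀ t : ℝ, HasDerivAt (fun t : ℝ => f (z₀ + t • (z - z₀)))
        (fderiv ℝ f (z₀ + t • (z - z₀)) (z - z₀)) t := by
      intro t
      have h2 : HasDerivAt (fun t : ℝ => z₀ + t • (z - z₀)) (z - z₀) t := by
        simpa using ((hasDerivAt_id t).smul_const (z - z₀)).const_add z₀
      exact (hf.differentiable (by simp) _).hasFDerivAt.comp_hasDerivAt t h2
    have hc : Continuous fun t : ℝ => fderiv ℝ f (z₀ + t • (z - z₀)) := by
      have := hd.continuous
      fun_prop
    have h3 := intervalIntegral.integral_eq_sub_of_hasDerivAt (a := 0) (b := 1)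
      (fun t _ => hder t) ((hc.clm_apply continuous_const).intervalIntegrable _ _)
    have h4 : Φ z (z - z₀) = ∫ t in (0 : ℝ)..1, fderiv ℝ f (z₀ + t • (z - z₀)) (z - z₀) := by
      simp only [hΦ, pow_zero, one_smul]
      exact ContinuousLinearMap.intervalIntegral_apply (hc.intervalIntegrable _ _) _
    rw [h4, h3]
    simp
  have hdecomp : ∀ (T : ℂ →L[ℝ] ℂ) (h : ℂ),
      T h = h * ((T 1 - I * T I) / 2) + conj h * ((T 1 + I * T I) / 2) := by
    intro T h
    have h5 : T h = h.re * T 1 + h.im * T I := by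
      conv_lhs => rw [show h = h.re • (1 : ℂ) + h.im • I by simp]
      rw [map_add, map_smul, map_smul]
      simp
    have h6 : conj h = h.re - h.im * I := by
      apply Complex.ext <;> simp
    have h7 : h = h.re + h.im * I := (re_add_im h).symm
    rw [h5, h6]
    conv_rhs => enter [1, 1]; rw [h7]
    linear_combination ((h.im : ℂ) * T I) * I_sq
  linear_combination hmain + hdecomp (Φ z) (z - z₀)

end Hadamard

section Division

open scoped ContDiff

/-- A smooth function all of whose pure `z̄`-derivatives vanish at `z₀`. -/
def DbarFlat (f : ℂ → ℂ) (z₀ : ℂ) : Prop :=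
  ContDiff ℝ ∞ f ∧ ∀ k : ℕ, Dbar^[k] f z₀ = 0

lemma DbarFlat.exists_hadamard {f : ℂ → ℂ} {z₀ : ℂ} (hf : DbarFlat f z₀) :
    ∃ a b : ℂ → ℂ, ContDiff ℝ ∞ a ∧ DbarFlat b z₀ ∧
      ∀ z, f z = (z - z₀) * a z + conj (z - z₀) * b z := by
  obtain ⟨a, b, ha, hb, h⟩ := TBG.exists_hadamard hf.1 z₀
  have h0 : f z₀ = 0 := hf.2 0
  simp only [h0, zero_add] at h
  refine ⟨a, b, ha, ⟨hb, fun k => ?_⟩, h⟩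
  have hk := hf.2 (k + 1)
  rw [funext h, iterate_Dbar_add (f := fun z => (z - z₀) * a z)
    ((contDiff_id.sub contDiff_const).mul ha)
    ((contDiff_conj_sub z₀).mul hb), iterate_Dbar_sub_mul ha, iterate_Dbar_conj_sub_mul hb] at hk
  have hk1 : (k : ℂ) + 1 ≠ 0 := Nat.cast_add_one_ne_zero k
  simpa [hk1] using hk

lemma DbarFlat.exists_hadamard_pow {f : ℂ → ℂ} {z₀ : ℂ} (hf : DbarFlat f z₀) (n : ℕ) :
    ∃ a b : ℂ → ℂ, ContDiff ℝ ∞ a ∧ DbarFlat b z₀ ∧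
      ∀ z, f z = (z - z₀) * a z + conj (z - z₀) ^ n * b z := by
  induction n with
  | zero => exact ⟨0, f, contDiff_const, hf, by simp⟩
  | succ n ih =>
    obtain ⟨a, b, ha, hb, h⟩ := ih
    obtain ⟨a', b', ha', hb', h'⟩ := hb.exists_hadamard
    refine ⟨fun z => a z + conj (z - z₀) ^ n * a' z, b',
      ha.add (((contDiff_conj_sub z₀).pow n).mul ha'), hb', fun z => ?_⟩
    rw [h, h']
    ring

lemma contDiff_conj_pow_div_pow (k : ℕ) : ∀ n m : ℕ, m + k + 1 ≤ n →
    ContDiff ℝ k (fun z : ℂ => conj z ^ n / z ^ m) := by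
  have hnorm : ∀ (n m : ℕ), m ≤ n → ∀ z : ℂ, z ≠ 0 → ‖conj z ^ n / z ^ m‖ = ‖z‖ ^ (n - m) := by
    intro n m h z hz
    rw [norm_div, norm_pow, norm_pow, RCLike.norm_conj, pow_sub₀ _ (norm_ne_zero_iff.2 hz) h,
      div_eq_mul_inv]
  have key : ∀ n m : ℕ, m + 2 ≤ n → ∀ z : ℂ, HasFDerivAt (fun z : ℂ => conj z ^ n / z ^ m)
      ((n * (conj z ^ (n - 1) / z ^ m)) • (conjCLE : ℂ →L[ℝ] ℂ) -
        (m * (conj z ^ n / z ^ (m + 1))) • ContinuousLinearMap.id ℝ ℂ) z := by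
    intro n m h z
    rcases eq_or_ne z 0 with rfl | hz
    · have h1 : (n - 1) ≠ 0 := by omega
      have h2 : n ≠ 0 := by omega
      have h3 : ((n * (conj (0 : ℂ) ^ (n - 1) / 0 ^ m)) • (conjCLE : ℂ →L[ℝ] ℂ) -
          (m * (conj (0 : ℂ) ^ n / 0 ^ (m + 1))) • ContinuousLinearMap.id ℝ ℂ) = 0 := by
        ext; simp [h1, h2]
      rw [h3, hasFDerivAt_iff_isLittleO_nhds_zero]
      simp only [map_zero, ne_eq, not_false_eq_true, zero_pow, zero_div, h2, zero_add, sub_zero,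
        _root_.zero_apply]
      refine Asymptotics.IsBigO.trans_isLittleO (g := fun z : ℂ => ‖z‖ ^ (n - m)) ?_ ?_
      · refine Asymptotics.IsBigO.of_bound 1 (.of_forall fun z => ?_)
        rcases eq_or_ne z 0 with rfl | hz
        · simp [h2]
        · rw [hnorm n m (by omega) z hz]; simp
      · exact (Asymptotics.isLittleO_norm_pow_id (show 1 < n - m by omega))
    · have hc : HasFDerivAt (fun z : ℂ => conj z ^ n)
          ((n * conj z ^ (n - 1)) • (conjCLE : ℂ →L[ℝ] ℂ)) z :=
        ((hasDerivAt_pow n (conj z)).hasFDerivAt.restrictScalars ℝ).comp z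
          (conjCLE : ℂ →L[ℝ] ℂ).hasFDerivAt |>.congr_fderiv (by ext; simp [mul_comm])
      have hp : HasFDerivAt (fun z : ℂ => (z ^ m)⁻¹)
          ((-(m * z ^ (m - 1)) / (z ^ m) ^ 2) • ContinuousLinearMap.id ℝ ℂ) z :=
        (((hasDerivAt_pow m z).inv (pow_ne_zero m hz)).hasFDerivAt.restrictScalars ℝ).congr_fderiv
          (by ext; simp [mul_comm])
      refine ((hc.mul hp).congr_fderiv ?_).congr_of_eventuallyEq
        (.of_forall fun z => div_eq_mul_inv _ _)
      rcases m with _ | m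
      · ext; simp
      · have e : z ^ m / (z ^ (m + 1)) ^ 2 = 1 / z ^ (m + 2) := by
          field_simp
          ring
        ext; simp [neg_div, mul_div_assoc, e]; ring
  induction k with
  | zero =>
    intro n m h
    refine contDiff_zero.2 (continuous_iff_continuousAt.2 fun z => ?_)
    rcases eq_or_ne z 0 with rfl | hz
    · have h2 : n ≠ 0 := by omega
      rw [ContinuousAt, map_zero, zero_pow h2, zero_div]
      refine squeeze_zero_norm (a := fun z : ℂ => ‖z‖ ^ (n - m)) (fun z => ?_) ?_
      · rcases eq_or_ne z 0 with rfl | hz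
        · simp [h2]
        · exact (hnorm n m (by omega) z hz).le
      · have : n - m ≠ 0 := by omega
        have h3 : Continuous fun z : ℂ => ‖z‖ ^ (n - m) := by fun_prop
        simpa [this] using h3.tendsto 0
    · exact ContinuousAt.div (by fun_prop) (by fun_prop) (pow_ne_zero m hz)
  | succ k ih =>
    intro n m h
    push_cast
    rw [contDiff_succ_iff_fderiv]
    refine ⟨fun z => (key n m (by omega) z).differentiableAt, by simp, ?_⟩
    rw [show fderiv ℝ (fun z : ℂ => conj z ^ n / z ^ m) = _ from
      funext fun z => (key n m (by omega) z).fderiv]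
    exact ((contDiff_const.mul (ih (n - 1) m (by omega))).smul contDiff_const).sub
      ((contDiff_const.mul (ih n (m + 1) (by omega))).smul contDiff_const)

lemma eq_of_eq_off_point {f g : ℂ → ℂ} {z₀ : ℂ} (hf : ContinuousAt f z₀) (hg : ContinuousAt g z₀)
    (h : f =ᶠ[𝓝[≠] z₀] g) : f z₀ = g z₀ :=
  ((hf.eventuallyEq_nhds_iff_eventuallyEq_nhdsNE hg).1 h).self_of_nhds

lemma DbarFlat.exists_eq_sub_mul {f : ℂ → ℂ} {z₀ : ℂ} (hf : DbarFlat f z₀) :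
    ∃ w : ℂ → ℂ, ContDiff ℝ ∞ w ∧ ∀ z, f z = (z - z₀) * w z := by
  have H : ∀ k : ℕ, ∃ w : ℂ → ℂ, ContDiff ℝ k w ∧ ∀ z, f z = (z - z₀) * w z := by
    intro k
    obtain ⟨a, b, ha, hb, h⟩ := hf.exists_hadamard_pow (k + 2)
    refine ⟨fun z => a z + conj (z - z₀) ^ (k + 2) / (z - z₀) ^ 1 * b z, ?_, fun z => ?_⟩
    · have h1 : ContDiff ℝ k (fun z : ℂ => conj (z - z₀) ^ (k + 2) / (z - z₀) ^ 1) :=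
        (contDiff_conj_pow_div_pow k (k + 2) 1 (by omega)).comp (contDiff_id.sub contDiff_const)
      have hle : (k : ℕ∞ω) ≤ ∞ := by exact_mod_cast le_top
      exact (ha.of_le hle).add (h1.mul (hb.1.of_le hle))
    · rw [h]
      rcases eq_or_ne z z₀ with rfl | hz
      · simp
      · have : z - z₀ ≠ 0 := sub_ne_zero.2 hz
        field_simp
  obtain ⟨w, hw, h⟩ := H 0
  refine ⟨w, contDiff_infty.2 fun k => ?_, h⟩
  obtain ⟨w', hw', h'⟩ := H k
  have hoff : ∀ z, z ≠ z₀ → w z = w' z := fun z hz =>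
    mul_left_cancel₀ (sub_ne_zero.2 hz) ((h z).symm.trans (h' z))
  have : w = w' := by
    funext z
    rcases eq_or_ne z z₀ with rfl | hz
    · exact eq_of_eq_off_point hw.continuous.continuousAt hw'.continuous.continuousAt
        (eventually_mem_nhdsWithin.mono hoff)
    · exact hoff z hz
  rwa [this]

lemma dbarFlat_of_system {f g p q : ℂ → ℂ} (hf : ContDiff ℝ ∞ f) (hg : ContDiff ℝ ∞ g)
    (hp : ContDiff ℝ ∞ p) (hq : ContDiff ℝ ∞ q) (hfg : ∀ z, Dbar f z = p z * g z)
    (hgf : ∀ z, Dbar g z = q z * f z) {z₀ : ℂ} (hf0 : f z₀ = 0) (hg0 : g z₀ = 0) :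
    DbarFlat f z₀ := by
  have key : ∀ k : ℕ, ∀ A B : ℂ → ℂ, ContDiff ℝ ∞ A → ContDiff ℝ ∞ B →
      Dbar^[k] (fun z => A z * f z + B z * g z) z₀ = 0 := by
    intro k
    induction k with
    | zero => intro A B _ _; simp [hf0, hg0]
    | succ k ih =>
      intro A B hA hB
      rw [iterate_succ_apply]
      have : Dbar (fun z => A z * f z + B z * g z) =
          fun z => (Dbar A z + B z * q z) * f z + (Dbar B z + A z * p z) * g z := by
        funext z
        rw [Dbar_add (smooth_differentiableAt (hA.mul hf) z)
          (smooth_differentiableAt (hB.mul hg) z),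
          Dbar_mul (smooth_differentiableAt hA z) (smooth_differentiableAt hf z),
          Dbar_mul (smooth_differentiableAt hB z) (smooth_differentiableAt hg z), hfg, hgf]
        ring
      rw [this]
      exact ih _ _ ((contDiff_Dbar hA).add (hB.mul hq)) ((contDiff_Dbar hB).add (hA.mul hp))
  refine ⟨hf, fun k => ?_⟩
  simpa using key k (fun _ => 1) (fun _ => 0) contDiff_const contDiff_const

lemma Dbar_quotient {f g p w₁ w₂ : ℂ → ℂ} {z₀ : ℂ} (hp : ContDiff ℝ ∞ p) (hw₁ : ContDiff ℝ ∞ w₁)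
    (hw₂ : ContDiff ℝ ∞ w₂) (hf : ∀ z, f z = (z - z₀) * w₁ z) (hg : ∀ z, g z = (z - z₀) * w₂ z)
    (hfg : ∀ z, Dbar f z = p z * g z) (z : ℂ) : Dbar w₁ z = p z * w₂ z := by
  have hoff : ∀ z, z ≠ z₀ → Dbar w₁ z = p z * w₂ z := by
    intro z hz
    have h := hfg z
    rw [funext hf, hg, Dbar_mul (by fun_prop) (smooth_differentiableAt hw₁ z), Dbar_sub_const] at h
    exact mul_left_cancel₀ (sub_ne_zero.2 hz) (by linear_combination h)
  rcases eq_or_ne z z₀ with rfl | hz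
  · exact eq_of_eq_off_point (contDiff_Dbar hw₁).continuous.continuousAt
      (hp.mul hw₂).continuous.continuousAt (eventually_mem_nhdsWithin.mono hoff)
  · exact hoff z hz

/-- A smooth solution of the off-diagonal `∂̄`-system that vanishes at `z₀` is `z - z₀` times a
smooth solution. -/
lemma exists_quotient_of_system {f g p q : ℂ → ℂ} (hf : ContDiff ℝ ∞ f) (hg : ContDiff ℝ ∞ g)
    (hp : ContDiff ℝ ∞ p) (hq : ContDiff ℝ ∞ q) (hfg : ∀ z, Dbar f z = p z * g z)
    (hgf : ∀ z, Dbar g z = q z * f z) {z₀ : ℂ} (hf0 : f z₀ = 0) (hg0 : g z₀ = 0) :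
    ∃ w₁ w₂ : ℂ → ℂ, ContDiff ℝ ∞ w₁ ∧ ContDiff ℝ ∞ w₂ ∧ (∀ z, f z = (z - z₀) * w₁ z) ∧
      (∀ z, g z = (z - z₀) * w₂ z) ∧ (∀ z, Dbar w₁ z = p z * w₂ z) ∧
      (∀ z, Dbar w₂ z = q z * w₁ z) := by
  obtain ⟨w₁, hw₁, h₁⟩ := (dbarFlat_of_system hf hg hp hq hfg hgf hf0 hg0).exists_eq_sub_mul
  obtain ⟨w₂, hw₂, h₂⟩ := (dbarFlat_of_system hg hf hq hp hgf hfg hg0 hf0).exists_eq_sub_mul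
  exact ⟨w₁, w₂, hw₁, hw₂, h₁, h₂, Dbar_quotient hp hw₁ hw₂ h₁ h₂ hfg,
    Dbar_quotient hq hw₂ hw₁ h₂ h₁ hgf⟩

end Division

section Gluing

open scoped ContDiff

lemma eventually_nhds_of_nhdsNE {z₀ : ℂ} {p : ℂ → Prop} (h : ∀ᶠ z in 𝓝[≠] z₀, p z) :
    ∀ᶠ z in 𝓝[≠] z₀, ∀ᶠ w in 𝓝 z, p w := by
  filter_upwards [eventually_eventually_nhdsWithin.2 h, self_mem_nhdsWithin] with z hz hne
  rwa [isOpen_compl_singleton.nhdsWithin_eq hne] at hz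

lemma eventually_nhdsNE_add {z₀ γ : ℂ} {p : ℂ → Prop} (h : ∀ᶠ z in 𝓝[≠] (z₀ + γ), p z) :
    ∀ᶠ z in 𝓝[≠] z₀, p (z + γ) := by
  have : Tendsto (fun z => z + γ) (𝓝[≠] z₀) (𝓝[≠] (z₀ + γ)) := by
    refine tendsto_nhdsWithin_iff.2 ⟨?_, ?_⟩
    · exact ((continuous_id.add continuous_const).tendsto z₀).mono_left nhdsWithin_le_nhds
    · filter_upwards [self_mem_nhdsWithin] with z hz
      simpa using hz
  exact this.eventually h

lemma exists_contDiff_extension {g : ℂ → ℂ}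
    (H : ∀ z₀, ∃ s : ℂ → ℂ, ContDiffAt ℝ ∞ s z₀ ∧ g =ᶠ[𝓝[≠] z₀] s) :
    ∃ v : ℂ → ℂ, ContDiff ℝ ∞ v ∧ ∀ z₀, v =ᶠ[𝓝[≠] z₀] g := by
  have hlim : ∀ {z : ℂ} {s : ℂ → ℂ}, ContinuousAt s z → g =ᶠ[𝓝[≠] z] s →
      limUnder (𝓝[≠] z) g = s z := fun hs h =>
    ((hs.tendsto.mono_left nhdsWithin_le_nhds).congr' h.symm).limUnder_eq
  have key : ∀ z₀ (s : ℂ → ℂ), ContDiffAt ℝ ∞ s z₀ → g =ᶠ[𝓝[≠] z₀] s →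
      ∀ᶠ z in 𝓝[≠] z₀, limUnder (𝓝[≠] z) g = s z ∧ g z = s z := by
    intro z₀ s hs h
    have hc : ∀ᶠ z in 𝓝 z₀, ContDiffAt ℝ 1 s z :=
      (hs.of_le (by exact_mod_cast le_top)).eventually (by simp)
    filter_upwards [eventually_nhds_of_nhdsNE h, hc.filter_mono nhdsWithin_le_nhds] with z hz hcz
    exact ⟨hlim hcz.continuousAt (hz.filter_mono nhdsWithin_le_nhds), hz.self_of_nhds⟩
  refine ⟨fun z => limUnder (𝓝[≠] z) g, contDiff_iff_contDiffAt.2 fun z₀ => ?_, fun z₀ => ?_⟩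
  · obtain ⟨s, hs, h⟩ := H z₀
    refine hs.congr_of_eventuallyEq ?_
    rw [← nhdsNE_sup_pure, EventuallyEq, eventually_sup]
    exact ⟨(key z₀ s hs h).mono fun z hz => hz.1, hlim hs.continuousAt h⟩
  · obtain ⟨s, hs, h⟩ := H z₀
    exact (key z₀ s hs h).mono fun z hz => hz.1.trans hz.2.symm

end Gluing

section Kernel

open scoped ContDiff

variable {Up Um : ℂ → ℂ} {α : ℂ} {u : ℂ → ℂ × ℂ}

lemma InKer.contDiff_fst {k : ℂ} (hu : InKer Up Um α k u) : ContDiff ℝ ∞ fun z => (u z).1 :=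
  ContDiff.fst hu.1

lemma InKer.contDiff_snd {k : ℂ} (hu : InKer Up Um α k u) : ContDiff ℝ ∞ fun z => (u z).2 :=
  ContDiff.snd hu.1

lemma InKer.Dbar_fst (hu : InKer Up Um α 0 u) (z : ℂ) :
    Dbar (fun w => (u w).1) z = -α * Up z * (u z).2 := by
  linear_combination hu.2.1 z

lemma InKer.Dbar_snd (hu : InKer Up Um α 0 u) (z : ℂ) :
    Dbar (fun w => (u w).2) z = -α * Um z * (u z).1 := by
  linear_combination hu.2.2.1 z

lemma Dbar_extension {F f g p v₁ v₂ : ℂ → ℂ} (hF : ∀ z₀, MeromorphicAt F z₀)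
    (hf : ContDiff ℝ ∞ f) (hp : ContDiff ℝ ∞ p) (hfg : ∀ z, Dbar f z = p z * g z)
    (hv₁ : ContDiff ℝ ∞ v₁) (hv₂ : ContDiff ℝ ∞ v₂)
    (h₁ : ∀ z₀, v₁ =ᶠ[𝓝[≠] z₀] fun z => F z * f z)
    (h₂ : ∀ z₀, v₂ =ᶠ[𝓝[≠] z₀] fun z => F z * g z) (z : ℂ) :
    Dbar v₁ z = p z * v₂ z := by
  refine eq_of_eq_off_point (g := fun z => p z * v₂ z)
    (contDiff_Dbar hv₁).continuous.continuousAt (hp.mul hv₂).continuous.continuousAt ?_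
  filter_upwards [eventually_nhds_of_nhdsNE (h₁ z), h₂ z, (hF z).eventually_analyticAt]
    with w hw₁ hw₂ hFw
  have hFd : DifferentiableAt ℝ F w := hFw.differentiableAt.restrictScalars ℝ
  rw [Dbar_congr hw₁, hw₂, Dbar_mul hFd (smooth_differentiableAt hf w),
    Dbar_of_differentiableAt hFw.differentiableAt, hfg]
  ring

lemma extension_quasiperiodic {F f v : ℂ → ℂ} {γ χ : ℂ} (hF : ∀ z, F (z + γ) = F z)
    (hf : ∀ z, f (z + γ) = χ * f z) (hv : ContDiff ℝ ∞ v)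
    (h : ∀ z₀, v =ᶠ[𝓝[≠] z₀] fun z => F z * f z) (z : ℂ) : v (z + γ) = χ * v z := by
  refine eq_of_eq_off_point (f := fun z => v (z + γ)) (g := fun z => χ * v z)
    (hv.continuous.comp (continuous_id.add continuous_const)).continuousAt
    (continuous_const.mul hv.continuous).continuousAt ?_
  filter_upwards [h z, eventually_nhdsNE_add (h (z + γ))] with w hw hw'
  rw [hw, hw', hF, hf]
  ring

/-- A `Λ`-periodic meromorphic multiple of a kernel element whose singularities are removable
extends to a kernel element. -/
lemma InKer.exists_meromorphic_mul (hUp : ContDiff ℝ ∞ Up) (hUm : ContDiff ℝ ∞ Um)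
    (hu : InKer Up Um α 0 u) {F : ℂ → ℂ} (hF : ∀ z₀, MeromorphicAt F z₀)
    (hper : ∀ γ ∈ Λ, ∀ z, F (z + γ) = F z)
    (H : ∀ z₀, ∃ h w₁ w₂ : ℂ → ℂ, AnalyticAt ℂ h z₀ ∧ ContDiff ℝ ∞ w₁ ∧ ContDiff ℝ ∞ w₂ ∧
      ∀ᶠ z in 𝓝[≠] z₀, F z * (u z).1 = h z * w₁ z ∧ F z * (u z).2 = h z * w₂ z) :
    ∃ v, InKer Up Um α 0 v ∧ ∀ z₀, ∀ᶠ z in 𝓝[≠] z₀, v z = F z • u z := by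
  have hs : ∀ {h w : ℂ → ℂ} {z₀ : ℂ}, AnalyticAt ℂ h z₀ → ContDiff ℝ ∞ w →
      ContDiffAt ℝ ∞ (fun z => h z * w z) z₀ := fun hh hw =>
    hh.restrictScalars.contDiffAt.mul hw.contDiffAt
  obtain ⟨v₁, hv₁, h₁⟩ := exists_contDiff_extension (g := fun z => F z * (u z).1) fun z₀ => by
    obtain ⟨h, w₁, w₂, hh, hw₁, hw₂, e⟩ := H z₀
    exact ⟨_, hs hh hw₁, e.mono fun z hz => hz.1⟩
  obtain ⟨v₂, hv₂, h₂⟩ := exists_contDiff_extension (g := fun z => F z * (u z).2) fun z₀ => by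
    obtain ⟨h, w₁, w₂, hh, hw₁, hw₂, e⟩ := H z₀
    exact ⟨_, hs hh hw₂, e.mono fun z hz => hz.2⟩
  refine ⟨fun z => (v₁ z, v₂ z), ⟨hv₁.prodMk hv₂, fun z => ?_, fun z => ?_, fun γ hγ z => ?_,
    fun γ hγ z => ?_⟩, fun z₀ => ?_⟩
  · linear_combination Dbar_extension hF hu.contDiff_fst (contDiff_const.mul hUp)
      hu.Dbar_fst hv₁ hv₂ h₁ h₂ z
  · linear_combination Dbar_extension hF hu.contDiff_snd (contDiff_const.mul hUm)
      hu.Dbar_snd hv₂ hv₁ h₂ h₁ z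
  · exact extension_quasiperiodic (hper γ hγ) (hu.2.2.2.1 γ hγ) hv₁ h₁ z
  · exact extension_quasiperiodic (hper γ hγ) (hu.2.2.2.2 γ hγ) hv₂ h₂ z
  · filter_upwards [h₁ z₀, h₂ z₀] with z hz₁ hz₂
    exact Prod.ext hz₁ hz₂

lemma exists_generator_of_kerDim_eq_one {k : ℂ} (h : kerDim Up Um α k = 1) :
    ∃ u, InKer Up Um α k u ∧ u ≠ 0 ∧ ∀ v, InKer Up Um α k v → ∃ c : ℂ, v = c • u := by
  obtain ⟨u, hu, hne⟩ : ∃ u ∈ kerSet Up Um α k, u ≠ 0 := by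
    by_contra! hcon
    rw [kerDim, Submodule.span_eq_bot.2 hcon] at h
    simp at h
  refine ⟨u, hu, hne, fun v hv => ?_⟩
  have hu' : (⟨u, Submodule.subset_span hu⟩ : Submodule.span ℂ (kerSet Up Um α k)) ≠ 0 := by
    simpa [Subtype.ext_iff] using hne
  obtain ⟨c, hc⟩ := (finrank_eq_one_iff_of_nonzero' _ hu').1 h ⟨v, Submodule.subset_span hv⟩
  exact ⟨c, by simpa using (congrArg Subtype.val hc).symm⟩

/-- If the kernel is a line, every periodic meromorphic multiplier preserving it is constant. -/
lemma InKer.meromorphic_multiplier_const (hUp : ContDiff ℝ ∞ Up) (hUm : ContDiff ℝ ∞ Um)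
    (hu : InKer Up Um α 0 u) (hne : u ≠ 0) (hgen : ∀ v, InKer Up Um α 0 v → ∃ c : ℂ, v = c • u)
    {F : ℂ → ℂ} (hF : ∀ z₀, MeromorphicAt F z₀) (hper : ∀ γ ∈ Λ, ∀ z, F (z + γ) = F z)
    (H : ∀ z₀, ∃ h w₁ w₂ : ℂ → ℂ, AnalyticAt ℂ h z₀ ∧ ContDiff ℝ ∞ w₁ ∧ ContDiff ℝ ∞ w₂ ∧
      ∀ᶠ z in 𝓝[≠] z₀, F z * (u z).1 = h z * w₁ z ∧ F z * (u z).2 = h z * w₂ z) :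
    ∃ c : ℂ, ∀ z₀, ∀ᶠ z in 𝓝[≠] z₀, F z = c := by
  obtain ⟨v, hv, hvF⟩ := hu.exists_meromorphic_mul hUp hUm hF hper H
  obtain ⟨c, rfl⟩ := hgen v hv
  obtain ⟨z₁, hz₁⟩ : ∃ z, u z ≠ 0 := Function.ne_iff.1 hne
  have h₁ : ∀ᶠ z in 𝓝[≠] z₁, F z - c = 0 := by
    filter_upwards [hvF z₁, (hu.1.continuous.continuousAt.eventually_ne hz₁).filter_mono
      nhdsWithin_le_nhds] with z hz hne
    exact sub_eq_zero.2 (smul_left_injective ℂ hne hz.symm)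
  have hm : MeromorphicOn (fun z => F z - c) Set.univ := fun z _ =>
    (hF z).fun_sub (MeromorphicAt.const c z)
  refine ⟨c, fun z₀ => ?_⟩
  by_contra hcon
  refine hm.meromorphicOrderAt_ne_top_of_isPreconnected isPreconnected_univ (Set.mem_univ z₀)
    (Set.mem_univ z₁) (fun h => hcon ?_) (meromorphicOrderAt_eq_top_iff.2 h₁)
  exact (meromorphicOrderAt_eq_top_iff.1 h).mono fun z hz => sub_eq_zero.1 hz

end Kernel

section Rotation

lemma ω_pow_three : ω ^ 3 = 1 := by
  rw [ω, ← Complex.exp_nat_mul, ← Complex.exp_two_pi_mul_I]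
  congr 1
  push_cast
  ring

lemma ω_eq : ω = ⟨-1 / 2, √3 / 2⟩ := by
  have h : (2 * Real.pi * Complex.I / 3 : ℂ) = ((2 * Real.pi / 3 : ℝ) : ℂ) * Complex.I := by
    push_cast
    ring
  have h' : 2 * Real.pi / 3 = Real.pi - Real.pi / 3 := by ring
  rw [ω, h]
  apply Complex.ext
  · rw [Complex.exp_ofReal_mul_I_re, h', Real.cos_pi_sub, Real.cos_pi_div_three]
    norm_num
  · rw [Complex.exp_ofReal_mul_I_im, h', Real.sin_pi_sub, Real.sin_pi_div_three]

lemma ω_ne_one : ω ≠ 1 := fun h => by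
  have := congrArg Complex.re (ω_eq.symm.trans h)
  norm_num at this

lemma ω_ne_zero : ω ≠ 0 := Complex.exp_ne_zero _

lemma ω_sq : ω ^ 2 = -1 - ω := by
  have h : (ω - 1) * (ω ^ 2 + ω + 1) = 0 := by linear_combination ω_pow_three
  linear_combination (mul_eq_zero.1 h).resolve_left (sub_ne_zero.2 ω_ne_one)

lemma ω_sq_ne_one : ω ^ 2 ≠ 1 := fun h => ω_ne_one (by
  linear_combination ω_pow_three - ω * h)

lemma one_add_ω_ne_zero : 1 + ω ≠ 0 := fun h =>
  pow_ne_zero 2 ω_ne_zero (by linear_combination ω_sq - h)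

lemma ω_mul_mem {γ : ℂ} (hγ : γ ∈ Λ) : ω * γ ∈ Λ := by
  obtain ⟨m, n, rfl⟩ := hγ
  refine ⟨n - m, -m, ?_⟩
  push_cast
  linear_combination (m : ℂ) * ω_sq

lemma exp_pair_K (m n : ℤ) :
    Complex.exp (Complex.I * (pair (m * ω + n) K : ℂ)) = ω ^ (-(m + n)) := by
  have hp : pair (m * ω + n) K = (-m / 2 + n) * (4 * Real.pi / 3) := by
    have hK : K = ((4 * Real.pi / 3 : ℝ) : ℂ) := by
      rw [K]
      push_cast
      ring
    rw [pair, hK, Complex.conj_ofReal, Complex.re_mul_ofReal, ω_eq]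
    simp
    ring
  rw [hp, ω, ← Complex.exp_int_mul, Complex.exp_eq_exp_iff_exists_int]
  refine ⟨n, ?_⟩
  push_cast
  ring

lemma exp_pair_K_ω_mul {γ : ℂ} (hγ : γ ∈ Λ) :
    Complex.exp (Complex.I * (pair (ω * γ) K : ℂ)) = Complex.exp (Complex.I * (pair γ K : ℂ)) := by
  obtain ⟨m, n, rfl⟩ := hγ
  have h : ω * (m * ω + n) = ((n - m : ℤ) : ℂ) * ω + ((-m : ℤ) : ℂ) := by
    push_cast
    linear_combination (m : ℂ) * ω_sq
  have h3 : ω ^ (3 * m) = 1 := by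
    rw [zpow_mul]
    exact_mod_cast (by rw [ω_pow_three, one_zpow] : (ω ^ 3) ^ m = 1)
  rw [h, exp_pair_K, exp_pair_K, show -(n - m + -m) = -(m + n) + 3 * m by ring,
    zpow_add₀ ω_ne_zero, h3, mul_one]

lemma Dbar_comp_mul {f : ℂ → ℂ} (hf : ContDiff ℝ (⊤ : ℕ∞) f) (c z : ℂ) :
    Dbar (fun w => f (c * w)) z = conj c * Dbar f (c * z) := by
  have hL : HasFDerivAt (fun w : ℂ => c * w) (c • ContinuousLinearMap.id ℝ ℂ) z :=
    (hasFDerivAt_id z).const_mul c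
  have h := (smooth_differentiableAt hf (c * z)).hasFDerivAt.comp z hL
  have key : ∀ v : ℂ, fderiv ℝ f (c * z) v =
      v.re * fderiv ℝ f (c * z) 1 + v.im * fderiv ℝ f (c * z) Complex.I := fun v => by
    conv_lhs => rw [show v = v.re • (1 : ℂ) + v.im • Complex.I by simp [Complex.re_add_im]]
    rw [map_add, map_smul, map_smul, Complex.real_smul, Complex.real_smul]
  have e : fderiv ℝ (fun w => f (c * w)) z = _ := h.fderiv
  simp only [Dbar, e, ContinuousLinearMap.comp_apply, _root_.smul_apply,
    ContinuousLinearMap.id_apply, smul_eq_mul]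
  rw [key (c * 1), key (c * Complex.I)]
  have hc : conj c = c.re - c.im * Complex.I := by
    apply Complex.ext <;> simp
  simp only [mul_one, Complex.mul_re, Complex.mul_im, Complex.I_re, Complex.I_im, mul_zero,
    zero_sub, add_zero, Complex.ofReal_neg, hc]
  field_simp
  linear_combination ((c.im : ℂ) * fderiv ℝ f (c * z) Complex.I) *
    Complex.I_sq

lemma conj_ω_mul_ω : conj ω * ω = 1 := by
  rw [mul_comm, Complex.mul_conj, ω_eq, Complex.normSq_mk]
  norm_num [div_mul_div_comm]

variable {U : ℂ → ℂ} {α : ℂ} {u : ℂ → ℂ × ℂ}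

lemma InKer.exp_neg_pair {Up Um : ℂ → ℂ} {k : ℂ} (hu : InKer Up Um α k u) {γ : ℂ} (hγ : γ ∈ Λ)
    (z : ℂ) : (u (z + γ)).1 = (Complex.exp (Complex.I * (pair γ K : ℂ)))⁻¹ * (u z).1 := by
  rw [hu.2.2.2.1 γ hγ, ← Complex.exp_neg, neg_mul]

lemma InKer.comp_ω_mul (hU : IsTunnelling U) (hu : InKer U (fun z => U (-z)) α 0 u) :
    InKer U (fun z => U (-z)) α 0 fun z => u (ω * z) := by
  refine ⟨hu.1.comp (contDiff_const.mul contDiff_id), fun z => ?_, fun z => ?_, fun γ hγ z => ?_,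
    fun γ hγ z => ?_⟩
  · have h := Dbar_comp_mul hu.contDiff_fst ω z
    rw [hu.Dbar_fst, hU.2.2] at h
    simp only [h]
    linear_combination (-α * U z * (u (ω * z)).2) * conj_ω_mul_ω
  · have h := Dbar_comp_mul hu.contDiff_snd ω z
    rw [hu.Dbar_snd, ← mul_neg, hU.2.2] at h
    simp only [h]
    linear_combination (-α * U (-z) * (u (ω * z)).1) * conj_ω_mul_ω
  · simp only [mul_add]
    rw [hu.exp_neg_pair (ω_mul_mem hγ), exp_pair_K_ω_mul hγ, ← Complex.exp_neg, neg_mul]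
  · simp only [mul_add]
    rw [hu.2.2.2.2 _ (ω_mul_mem hγ), exp_pair_K_ω_mul hγ]

lemma InKer.exists_eigenvalue (hU : IsTunnelling U) (hu : InKer U (fun z => U (-z)) α 0 u)
    (hne : u ≠ 0) (hgen : ∀ v, InKer U (fun z => U (-z)) α 0 v → ∃ c : ℂ, v = c • u) :
    ∃ c : ℂ, (c = 1 ∨ c = ω ∨ c = ω ^ 2) ∧ ∀ z, u (ω * z) = c • u z := by
  obtain ⟨c, hc⟩ := hgen _ (hu.comp_ω_mul hU)
  have hc' : ∀ z, u (ω * z) = c • u z := fun z => congrFun hc z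
  refine ⟨c, ?_, hc'⟩
  obtain ⟨z, hz⟩ : ∃ z, u z ≠ 0 := Function.ne_iff.1 hne
  have h : c ^ 3 = 1 := by
    refine smul_left_injective ℂ hz ?_
    have h' := hc' (ω * (ω * z))
    rw [hc' (ω * z), hc' z, show ω * (ω * (ω * z)) = ω ^ 3 * z by ring, ω_pow_three, one_mul] at h'
    simp only [one_smul]
    rw [pow_succ, pow_two, mul_smul, mul_smul]
    exact h'.symm
  have : (c - 1) * ((c - ω) * (c - ω ^ 2)) = 0 := by
    linear_combination h + (c - 1) * (c * (-ω_sq) + ω_pow_three)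
  simpa [sub_eq_zero] using this

end Rotation

section DoubleZero

/-- The lattice `Λ` as the lattice of a period pair. -/
def periodPair : PeriodPair where
  ω₁ := ω
  ω₂ := 1
  indep := by
    rw [LinearIndependent.pair_iff]
    intro s t h
    have hi := congrArg Complex.im h
    have hr := congrArg Complex.re h
    simp only [ω_eq, Complex.add_im, Complex.add_re, Complex.smul_im, Complex.smul_re,
      Complex.one_im, Complex.one_re, smul_eq_mul, Complex.zero_im, Complex.zero_re] at hi hr
    have hs : s = 0 := by simpa using hi
    exact ⟨hs, by simpa [hs] using hr⟩

lemma mem_lattice_iff {γ : ℂ} : γ ∈ periodPair.lattice ↔ γ ∈ Λ := by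
  rw [PeriodPair.mem_lattice]
  simp only [periodPair, mul_one, Λ, Set.mem_ofPred_eq, eq_comm]

lemma neg_mem {γ : ℂ} (hγ : γ ∈ Λ) : -γ ∈ Λ :=
  mem_lattice_iff.1 (Submodule.neg_mem _ (mem_lattice_iff.2 hγ))

variable {Up Um : ℂ → ℂ} {α : ℂ} {u : ℂ → ℂ × ℂ}

lemma InKer.exists_eq_sub_mul (hUp : ContDiff ℝ (⊤ : ℕ∞) Up) (hUm : ContDiff ℝ (⊤ : ℕ∞) Um)
    (hu : InKer Up Um α 0 u) {z₀ : ℂ} (h : u z₀ = 0) :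
    ∃ w : ℂ → ℂ × ℂ, (ContDiff ℝ (⊤ : ℕ∞) fun z => (w z).1) ∧
      (ContDiff ℝ (⊤ : ℕ∞) fun z => (w z).2) ∧ (∀ z, u z = (z - z₀) • w z) ∧
      (∀ z, Dbar (fun z => (w z).1) z = -α * Up z * (w z).2) ∧
      ∀ z, Dbar (fun z => (w z).2) z = -α * Um z * (w z).1 := by
  obtain ⟨w₁, w₂, h₁, h₂, e₁, e₂, d₁, d₂⟩ := exists_quotient_of_system (z₀ := z₀) hu.contDiff_fst
    hu.contDiff_snd (contDiff_const.mul hUp) (contDiff_const.mul hUm) hu.Dbar_fst hu.Dbar_snd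
    (by simp [h]) (by simp [h])
  exact ⟨fun z => (w₁ z, w₂ z), h₁, h₂, fun z => Prod.ext (e₁ z) (e₂ z), d₁, d₂⟩

lemma InKer.exists_eq_sq_mul (hUp : ContDiff ℝ (⊤ : ℕ∞) Up) (hUm : ContDiff ℝ (⊤ : ℕ∞) Um)
    (hu : InKer Up Um α 0 u) (hrot : ∀ z, u (ω * z) = ω ^ 2 • u z) :
    ∃ w₁ w₂ : ℂ → ℂ, ContDiff ℝ (⊤ : ℕ∞) w₁ ∧ ContDiff ℝ (⊤ : ℕ∞) w₂ ∧
      ∀ z, u z = (z ^ 2 * w₁ z, z ^ 2 * w₂ z) := by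
  have hfix : ∀ {c : ℂ} {x : ℂ × ℂ}, c ≠ 1 → x = c • x → x = 0 := fun {c x} hc hx => by
    have : (1 - c) • x = 0 := by rw [sub_smul, one_smul, ← hx, sub_self]
    exact (smul_eq_zero.1 this).resolve_left (sub_ne_zero.2 hc.symm)
  have h0 : u 0 = 0 := hfix ω_sq_ne_one (by simpa using hrot 0)
  obtain ⟨w, hw₁, hw₂, hw, d₁, d₂⟩ := hu.exists_eq_sub_mul hUp hUm h0
  simp only [sub_zero] at hw
  have hrotw : ∀ z, w (ω * z) = ω • w z := by
    have hc : Continuous w := hw₁.continuous.prodMk hw₂.continuous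
    have hd : Dense {z : ℂ | z ≠ 0} := dense_compl_singleton 0
    refine fun z => congrFun (Continuous.ext_on hd (hc.comp (continuous_const.mul continuous_id))
      (hc.const_smul ω) fun z hz => ?_) z
    have h := hrot z
    rw [hw, hw, smul_smul, show ω ^ 2 * z = (ω * z) * ω by ring, mul_smul (ω * z) ω] at h
    exact smul_right_injective _ (mul_ne_zero ω_ne_zero hz) h
  have hw0 : w 0 = 0 := hfix ω_ne_one (by simpa using hrotw 0)
  obtain ⟨v₁, v₂, hv₁, hv₂, e₁, e₂, -, -⟩ := exists_quotient_of_system (z₀ := 0) hw₁ hw₂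
    (contDiff_const.mul hUp) (contDiff_const.mul hUm) d₁ d₂ (by simp [hw0]) (by simp [hw0])
  refine ⟨v₁, v₂, hv₁, hv₂, fun z => ?_⟩
  rw [hw]
  ext
  · simp [e₁, pow_two, mul_assoc]
  · simp [e₂, pow_two, mul_assoc]

lemma InKer.not_rotate_ω_sq (hUp : ContDiff ℝ (⊤ : ℕ∞) Up) (hUm : ContDiff ℝ (⊤ : ℕ∞) Um)
    (hu : InKer Up Um α 0 u) (hne : u ≠ 0) (hgen : ∀ v, InKer Up Um α 0 v → ∃ c : ℂ, v = c • u)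
    (hrot : ∀ z, u (ω * z) = ω ^ 2 • u z) : False := by
  obtain ⟨w₁, w₂, hw₁, hw₂, hw⟩ := hu.exists_eq_sq_mul hUp hUm hrot
  obtain ⟨c, hc⟩ := hu.meromorphic_multiplier_const hUp hUm hne hgen
    (F := periodPair.weierstrassP) periodPair.meromorphic_weierstrassP
    (fun γ hγ z => periodPair.weierstrassP_add_coe z ⟨γ, mem_lattice_iff.2 hγ⟩) fun z₀ => by
      by_cases hz₀ : z₀ ∈ periodPair.lattice
      · have hΛ := neg_mem (mem_lattice_iff.1 hz₀)
        have hs : ContDiff ℝ (⊤ : ℕ∞) fun z : ℂ => z + -z₀ := contDiff_id.add contDiff_const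
        refine ⟨fun z => (z - z₀) ^ 2 * periodPair.weierstrassPExcept z₀ z + 1 -
          (z - z₀) ^ 2 * (z₀ ^ 2)⁻¹,
          fun z => Complex.exp (Complex.I * (pair (-z₀) K : ℂ)) * w₁ (z + -z₀),
          fun z => (Complex.exp (Complex.I * (pair (-z₀) K : ℂ)))⁻¹ * w₂ (z + -z₀), ?_,
          contDiff_const.mul (hw₁.comp hs), contDiff_const.mul (hw₂.comp hs), ?_⟩
        · have := periodPair.analyticAt_weierstrassPExcept z₀
          fun_prop
        · filter_upwards [self_mem_nhdsWithin] with z hz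
          have h := periodPair.ite_eq_one_sub_sq_mul_weierstrassP z₀ hz₀ z
          rw [if_neg (show z ≠ z₀ from hz), div_eq_mul_inv] at h
          have h₁ := hu.exp_neg_pair hΛ z
          have h₂ := hu.2.2.2.2 _ hΛ z
          rw [hw (z + -z₀)] at h₁ h₂
          rw [← h]
          have hx := Complex.exp_ne_zero (Complex.I * (pair (-z₀) K : ℂ))
          constructor
          · field_simp at h₁
            linear_combination -periodPair.weierstrassP z * h₁
          · field_simp
            linear_combination -periodPair.weierstrassP z * h₂
      · exact ⟨periodPair.weierstrassP, fun z => (u z).1, fun z => (u z).2,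
          periodPair.analyticOnNhd_weierstrassP z₀ hz₀, hu.contDiff_fst, hu.contDiff_snd,
          .of_forall fun z => ⟨rfl, rfl⟩⟩
  have h := periodPair.order_weierstrassP 0 (Submodule.zero_mem _)
  rw [meromorphicOrderAt_congr (hc 0), meromorphicOrderAt_const] at h
  split_ifs at h <;> exact absurd h (by decide)

end DoubleZero

section CubicSeries

variable (L : PeriodPair) (p₁ p₂ p₃ : ℂ)

/-- The periodization `∑ 1 / ((z - l - p₁) (z - l - p₂) (z - l - p₃))` over a lattice. -/
def cubicSeries (z : ℂ) : ℂ :=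
  ∑' l : L.lattice, ((z - l - p₁) * (z - l - p₂) * (z - l - p₃))⁻¹

lemma norm_inv_cubic_le {r : ℝ} {s l : ℂ} (hr : 0 < r) (hs : ‖s‖ < r)
    (hl : 2 * (r + (‖p₁‖ + ‖p₂‖ + ‖p₃‖)) ≤ ‖l‖) :
    ‖((s - l - p₁) * (s - l - p₂) * (s - l - p₃))⁻¹‖ ≤ 8 * ‖l‖ ^ (-3 : ℝ) := by
  have h₁ := norm_nonneg p₁
  have h₂ := norm_nonneg p₂
  have h₃ := norm_nonneg p₃
  have hl0 : 0 < ‖l‖ := by linarith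
  have key : ∀ p : ℂ, ‖p‖ ≤ ‖p₁‖ + ‖p₂‖ + ‖p₃‖ → ‖l‖ / 2 ≤ ‖s - l - p‖ := fun p hp => by
    have e : l = (s - p) - (s - l - p) := by ring
    have := norm_sub_le (s - p) (s - l - p)
    rw [← e] at this
    linarith [norm_sub_le s p]
  rw [norm_inv, norm_mul, norm_mul]
  calc (‖s - l - p₁‖ * ‖s - l - p₂‖ * ‖s - l - p₃‖)⁻¹
      ≤ (‖l‖ / 2 * (‖l‖ / 2) * (‖l‖ / 2))⁻¹ := by
        gcongr
        · exact key _ (by linarith)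
        · exact key _ (by linarith)
        · exact key _ (by linarith)
    _ = 8 * (‖l‖ ^ 3)⁻¹ := by
        field_simp
        norm_num
    _ = 8 * ‖l‖ ^ (-3 : ℝ) := by norm_cast

lemma hasSumLocallyUniformly_cubic (T : Finset L.lattice) :
    HasSumLocallyUniformly
      (fun (l : L.lattice) z => if l ∈ T then 0 else ((z - l - p₁) * (z - l - p₂) * (z - l - p₃))⁻¹)
      fun z => ∑' l : L.lattice,
        if l ∈ T then 0 else ((z - l - p₁) * (z - l - p₂) * (z - l - p₃))⁻¹ := by
  refine L.hasSumLocallyUniformly_aux (u := fun _ l => 8 * ‖(l : ℂ)‖ ^ (-3 : ℝ)) _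
    (fun _ _ => (ZLattice.summable_norm_rpow _ _ (by simp; norm_num)).mul_left _) fun r hr =>
    Filter.eventually_atTop.mpr ⟨2 * (r + (‖p₁‖ + ‖p₂‖ + ‖p₃‖)), ?_⟩
  rintro _ h s hs l rfl
  split_ifs
  · rw [norm_zero]
    positivity
  · exact norm_inv_cubic_le p₁ p₂ p₃ hr hs h

lemma cubicSeries_add {γ : ℂ} (hγ : γ ∈ L.lattice) (z : ℂ) :
    cubicSeries L p₁ p₂ p₃ (z + γ) = cubicSeries L p₁ p₂ p₃ z := by
  rw [cubicSeries, cubicSeries, ← (Equiv.addRight (⟨γ, hγ⟩ : L.lattice)).tsum_eq]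
  refine tsum_congr fun l => ?_
  rw [Equiv.coe_addRight, Submodule.coe_add]
  congr 3 <;> ring

lemma cubicSeries_eq_add_sum (T : Finset L.lattice) (z : ℂ) :
    cubicSeries L p₁ p₂ p₃ z =
      (∑' l : L.lattice, if l ∈ T then 0 else ((z - l - p₁) * (z - l - p₂) * (z - l - p₃))⁻¹) +
        ∑ l ∈ T, ((z - l - p₁) * (z - l - p₂) * (z - l - p₃))⁻¹ := by
  have h := hasSum_sum_of_ne_finset_zero (L := .unconditional _) (s := T) (f := fun l : L.lattice =>
    if l ∈ T then ((z - l - p₁) * (z - l - p₂) * (z - l - p₃))⁻¹ else 0) fun l hl => if_neg hl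
  rw [Finset.sum_congr rfl fun l hl => if_pos hl] at h
  rw [← ((hasSumLocallyUniformly_cubic L p₁ p₂ p₃ T).hasSum.add h).tsum_eq, cubicSeries]
  refine tsum_congr fun l => ?_
  split_ifs <;> simp

variable {L p₁ p₂ p₃} {z₀ : ℂ} {T : Finset L.lattice}

lemma analyticAt_tsum_cubic
    (hT : ∀ l : L.lattice, l ∈ T ↔ z₀ - l = p₁ ∨ z₀ - l = p₂ ∨ z₀ - l = p₃) :
    AnalyticAt ℂ (fun z => ∑' l : L.lattice,
      if l ∈ T then 0 else ((z - l - p₁) * (z - l - p₂) * (z - l - p₃))⁻¹) z₀ := by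
  set S : Set ℂ := {z₀ - p₁, z₀ - p₂, z₀ - p₃} with hS
  have hTS : ∀ l : L.lattice, l ∈ T ↔ (l : ℂ) ∈ S := fun l => by
    simp only [hT, hS, Set.mem_insert_iff, Set.mem_singleton_iff,
      eq_sub_iff_add_eq, eq_comm, add_comm]
  have hO : ∀ p : ℂ, IsOpen ((fun z => z - p) ⁻¹' (L.lattice \ S : Set ℂ)ᶜ) := fun p =>
    L.isOpen_compl_lattice_sdiff.preimage (by fun_prop)
  have hV := ((hO p₁).inter (hO p₂)).inter (hO p₃)
  refine DifferentiableOn.analyticAt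
    ((hasSumLocallyUniformly_cubic L p₁ p₂ p₃ T).hasSumLocallyUniformlyOn.differentiableOn
      (.of_forall fun s => .fun_sum fun l _ => ?_) hV) (hV.mem_nhds ?_)
  · split_ifs with hl
    · simp
    · rintro z ⟨⟨h₁, h₂⟩, h₃⟩
      have key : ∀ p, z ∈ (fun z => z - p) ⁻¹' (L.lattice \ S : Set ℂ)ᶜ → z - l - p ≠ 0 := by
        intro p hp h
        refine hp ⟨?_, ?_⟩
        all_goals simp only [show z - p = l by linear_combination h]
        · exact l.2
        · rwa [← hTS]
      refine (DifferentiableAt.inv (by fun_prop) ?_).differentiableWithinAt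
      exact mul_ne_zero (mul_ne_zero (key _ h₁) (key _ h₂)) (key _ h₃)
  · simp [hS]

lemma exists_residue_form (h₁₂ : p₁ ≠ p₂) (h₁₃ : p₁ ≠ p₃) (h₂₃ : p₂ ≠ p₃) {l : ℂ}
    (hl : z₀ - l = p₁ ∨ z₀ - l = p₂ ∨ z₀ - l = p₃) :
    ∃ h : ℂ → ℂ, AnalyticAt ℂ h z₀ ∧
      h z₀ = ((z₀ - l - p₂) * (z₀ - l - p₃) + (z₀ - l - p₁) * (z₀ - l - p₃) +
        (z₀ - l - p₁) * (z₀ - l - p₂))⁻¹ ∧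
      ∀ z, ((z - l - p₁) * (z - l - p₂) * (z - l - p₃))⁻¹ = (z - z₀)⁻¹ * h z := by
  have key : ∀ p q : ℂ, z₀ - l ≠ p → z₀ - l ≠ q →
      AnalyticAt ℂ (fun z => ((z - l - p) * (z - l - q))⁻¹) z₀ := fun p q hp hq =>
    AnalyticAt.inv (by fun_prop) (mul_ne_zero (sub_ne_zero.2 hp) (sub_ne_zero.2 hq))
  rcases hl with h | h | h
  · refine ⟨_, key p₂ p₃ (h ▸ h₁₂) (h ▸ h₁₃), by simp [h], fun z => ?_⟩
    rw [← mul_inv, ← h]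
    ring
  · refine ⟨_, key p₁ p₃ (h ▸ h₁₂.symm) (h ▸ h₂₃), by simp [h], fun z => ?_⟩
    rw [← mul_inv, ← h]
    ring
  · refine ⟨_, key p₁ p₂ (h ▸ h₁₃.symm) (h ▸ h₂₃.symm), by simp [h], fun z => ?_⟩
    rw [← mul_inv, ← h]
    ring

lemma cubicSeries_residue_form (h₁₂ : p₁ ≠ p₂) (h₁₃ : p₁ ≠ p₃) (h₂₃ : p₂ ≠ p₃)
    (hT : ∀ l : L.lattice, l ∈ T ↔ z₀ - l = p₁ ∨ z₀ - l = p₂ ∨ z₀ - l = p₃) :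
    ∃ h : ℂ → ℂ, AnalyticAt ℂ h z₀ ∧
      h z₀ = ∑ l ∈ T, ((z₀ - l - p₂) * (z₀ - l - p₃) + (z₀ - l - p₁) * (z₀ - l - p₃) +
        (z₀ - l - p₁) * (z₀ - l - p₂))⁻¹ ∧
      ∀ z ≠ z₀, cubicSeries L p₁ p₂ p₃ z = (z - z₀)⁻¹ * h z := by
  choose! h hh hz e using fun (l : L.lattice) (hl : l ∈ T) =>
    exists_residue_form h₁₂ h₁₃ h₂₃ ((hT l).1 hl)
  have hG := analyticAt_tsum_cubic hT
  refine ⟨fun z => (z - z₀) * (∑' l : L.lattice,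
    if l ∈ T then 0 else ((z - l - p₁) * (z - l - p₂) * (z - l - p₃))⁻¹) + ∑ l ∈ T, h l z,
    ?_, ?_, fun z hne => ?_⟩
  · exact ((by fun_prop : AnalyticAt ℂ (fun z => z - z₀) z₀).mul hG).add
      (Finset.analyticAt_fun_sum T hh)
  · simp only [sub_self, zero_mul, zero_add]
    exact Finset.sum_congr rfl hz
  · rw [cubicSeries_eq_add_sum L p₁ p₂ p₃ T, Finset.sum_congr rfl fun l hl => e l hl z,
      ← Finset.mul_sum, mul_add, inv_mul_cancel_left₀ (sub_ne_zero.2 hne)]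

lemma exists_finset_poles (L : PeriodPair) (p₁ p₂ p₃ z₀ : ℂ) : ∃ T : Finset L.lattice,
    ∀ l : L.lattice, l ∈ T ↔ z₀ - l = p₁ ∨ z₀ - l = p₂ ∨ z₀ - l = p₃ := by
  have hf : ((fun l : L.lattice => z₀ - l) ⁻¹' {p₁, p₂, p₃}).Finite :=
    (Set.toFinite _).preimage fun l _ l' _ h => Subtype.ext (sub_right_injective h)
  exact ⟨hf.toFinset, fun l => by simp⟩

lemma meromorphicAt_cubicSeries (h₁₂ : p₁ ≠ p₂) (h₁₃ : p₁ ≠ p₃) (h₂₃ : p₂ ≠ p₃) (z₀ : ℂ) :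
    MeromorphicAt (cubicSeries L p₁ p₂ p₃) z₀ := by
  obtain ⟨T, hT⟩ := exists_finset_poles L p₁ p₂ p₃ z₀
  obtain ⟨h, hh, -, e⟩ := cubicSeries_residue_form h₁₂ h₁₃ h₂₃ hT
  have hm : MeromorphicAt (fun z => (z - z₀)⁻¹ * h z) z₀ :=
    (MeromorphicAt.inv (by fun_prop)).mul hh.meromorphicAt
  exact hm.congr (eventually_nhdsWithin_of_forall fun z hz => (e z hz).symm)

lemma analyticAt_cubicSeries
    (hz₀ : ∀ l : L.lattice, ¬(z₀ - l = p₁ ∨ z₀ - l = p₂ ∨ z₀ - l = p₃)) :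
    AnalyticAt ℂ (cubicSeries L p₁ p₂ p₃) z₀ := by
  refine (analyticAt_tsum_cubic (T := ∅) fun l => by simpa using hz₀ l).congr
    (.of_forall fun z => ?_)
  simp [cubicSeries]

end CubicSeries

section SimplePoles

/-- The stacking point `i / √3`, a fixed point of `z ↦ ω z - ω²`. -/
def stackingPoint : ℂ := (1 + 2 * ω) / 3

lemma ω_mul_stackingPoint : ω * stackingPoint = stackingPoint + (-1 - ω) := by
  rw [stackingPoint]
  linear_combination 2 / 3 * ω_sq

lemma stackingPoint_sq : stackingPoint ^ 2 = -1 / 3 := by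
  rw [stackingPoint]
  linear_combination 4 / 9 * ω_sq

lemma stackingPoint_ne_zero : stackingPoint ≠ 0 := fun h => by
  have := stackingPoint_sq
  rw [h] at this
  norm_num at this

lemma neg_one_sub_ω_mem : -1 - ω ∈ Λ := ⟨-1, -1, by push_cast; ring⟩

lemma two_mul_stackingPoint_notMem : 2 * stackingPoint ∉ Λ := by
  rintro ⟨m, n, h⟩
  rw [stackingPoint] at h
  have h' : (4 - 3 * m : ℂ) * ω + (2 - 3 * n) = 0 := by linear_combination 3 * h
  have hi := congrArg Complex.im h'
  rw [ω_eq] at hi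
  simp at hi
  have : (4 : ℤ) = 3 * m := by
    have : (4 : ℝ) = 3 * m := by linarith
    exact_mod_cast this
  omega

lemma exp_pair_neg_one_sub_ω : Complex.exp (Complex.I * (pair (-1 - ω) K : ℂ)) = ω ^ 2 := by
  have h := exp_pair_K (-1) (-1)
  rw [show ((-1 : ℤ) : ℂ) * ω + ((-1 : ℤ) : ℂ) = -1 - ω by push_cast; ring] at h
  rw [h]
  norm_cast

lemma stackingPoint_ne_neg : stackingPoint ≠ -stackingPoint := fun h =>
  stackingPoint_ne_zero (self_eq_neg.1 h)

lemma stackingPoint_ne_ω_mul : stackingPoint ≠ ω * stackingPoint := fun h =>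
  ω_ne_one (mul_right_cancel₀ stackingPoint_ne_zero (by rw [one_mul]; exact h.symm))

lemma neg_stackingPoint_ne_ω_mul : -stackingPoint ≠ ω * stackingPoint := fun h =>
  (mul_ne_zero one_add_ω_ne_zero stackingPoint_ne_zero) (by linear_combination -h)

variable {Up Um : ℂ → ℂ} {α : ℂ} {u : ℂ → ℂ × ℂ}

lemma InKer.eq_zero_add (hu : InKer Up Um α 0 u) {b γ : ℂ} (hb : u b = 0) (hγ : γ ∈ Λ) :
    u (b + γ) = 0 := by
  refine Prod.ext ?_ ?_
  · rw [hu.2.2.2.1 γ hγ, hb]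
    simp
  · rw [hu.2.2.2.2 γ hγ, hb]
    simp

lemma InKer.eq_zero_of_fixed (hu : InKer Up Um α 0 u) (hrot : ∀ z, u (ω * z) = u z) {b γ : ℂ}
    (hγ : γ ∈ Λ) (hb : ω * b = b + γ) (hχ : Complex.exp (Complex.I * (pair γ K : ℂ)) ≠ 1) :
    u b = 0 := by
  have h₁ := hu.exp_neg_pair hγ b
  have h₂ := hu.2.2.2.2 γ hγ b
  rw [← hb, hrot] at h₁ h₂
  refine Prod.ext ?_ ?_
  · have h : (1 - (Complex.exp (Complex.I * (pair γ K : ℂ)))⁻¹) * (u b).1 = 0 := by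
      linear_combination h₁
    exact (mul_eq_zero.1 h).resolve_left (sub_ne_zero.2 (inv_ne_one.2 hχ).symm)
  · have h : (1 - Complex.exp (Complex.I * (pair γ K : ℂ))) * (u b).2 = 0 := by
      linear_combination h₂
    exact (mul_eq_zero.1 h).resolve_left (sub_ne_zero.2 hχ.symm)

lemma InKer.eq_zero_stackingPoint (hu : InKer Up Um α 0 u) (hrot : ∀ z, u (ω * z) = u z) :
    u stackingPoint = 0 :=
  hu.eq_zero_of_fixed hrot neg_one_sub_ω_mem ω_mul_stackingPoint
    (exp_pair_neg_one_sub_ω ▸ ω_sq_ne_one)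

lemma InKer.eq_zero_neg_stackingPoint (hu : InKer Up Um α 0 u) (hrot : ∀ z, u (ω * z) = u z) :
    u (-stackingPoint) = 0 := by
  have hχ : Complex.exp (Complex.I * (pair (-(-1 - ω)) K : ℂ)) = (ω ^ 2)⁻¹ := by
    rw [← exp_pair_neg_one_sub_ω, ← Complex.exp_neg, pair, neg_mul, Complex.neg_re,
      Complex.ofReal_neg, mul_neg, pair]
  exact hu.eq_zero_of_fixed hrot (neg_mem neg_one_sub_ω_mem)
    (by linear_combination -ω_mul_stackingPoint) (hχ ▸ inv_ne_one.2 ω_sq_ne_one)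

lemma cubicSeries_stackingPoint_not_const (c : ℂ) :
    ¬∀ᶠ z in 𝓝[≠] stackingPoint, cubicSeries periodPair stackingPoint (-stackingPoint)
      (ω * stackingPoint) z = c := by
  intro hc
  have hγ : -(-1 - ω) ∈ periodPair.lattice := mem_lattice_iff.2 (neg_mem neg_one_sub_ω_mem)
  have ha0 : stackingPoint ≠ 0 := stackingPoint_ne_zero
  classical
  obtain ⟨h, hh, hha, e⟩ := cubicSeries_residue_form (L := periodPair) (z₀ := stackingPoint)
    (T := {0, ⟨-(-1 - ω), hγ⟩}) stackingPoint_ne_neg stackingPoint_ne_ω_mul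
    neg_stackingPoint_ne_ω_mul fun l => by
      rw [Finset.mem_insert, Finset.mem_singleton, Subtype.ext_iff, Subtype.ext_iff]
      simp only [Submodule.coe_zero]
      constructor
      · rintro (h | h)
        · exact Or.inl (by rw [h, sub_zero])
        · exact Or.inr (Or.inr (by rw [h, ω_mul_stackingPoint]; ring))
      · rintro (h | h | h)
        · exact Or.inl (by linear_combination -h)
        · refine absurd (mem_lattice_iff.1 l.2) ?_
          rw [show (l : ℂ) = 2 * stackingPoint by linear_combination -h]
          exact two_mul_stackingPoint_notMem
        · exact Or.inr (by linear_combination -h - ω_mul_stackingPoint)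
  have h0 : h stackingPoint = 0 := by
    refine tendsto_nhds_unique (hh.continuousAt.tendsto.mono_left nhdsWithin_le_nhds)
      (?_ : Tendsto h (𝓝[≠] stackingPoint) (𝓝 0))
    have hl : Tendsto (fun z => (z - stackingPoint) * c) (𝓝[≠] stackingPoint)
        (𝓝 ((stackingPoint - stackingPoint) * c)) :=
      (Continuous.tendsto (by fun_prop) stackingPoint).mono_left nhdsWithin_le_nhds
    rw [sub_self, zero_mul] at hl
    refine hl.congr' ?_
    filter_upwards [hc, self_mem_nhdsWithin] with z hz hne
    rw [← hz, e z hne, mul_inv_cancel_left₀ (sub_ne_zero.2 hne)]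
  rw [h0, Finset.sum_pair fun h => by
    have : (0 : ℂ) = -(-1 - ω) := congrArg Subtype.val h
    exact pow_ne_zero 2 ω_ne_zero (by rw [ω_sq]; linear_combination this)] at hha
  have e₁ : stackingPoint - -(-1 - ω) = ω * stackingPoint := by
    linear_combination -ω_mul_stackingPoint
  simp only [Submodule.coe_zero, sub_zero, e₁, sub_self, zero_mul, mul_zero, add_zero] at hha
  have hω : (1 - ω) ≠ 0 := sub_ne_zero.2 ω_ne_one.symm
  have hω' := one_add_ω_ne_zero
  have e₂ : (stackingPoint - -stackingPoint) * (stackingPoint - ω * stackingPoint) =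
      stackingPoint ^ 2 * (2 * (1 - ω)) := by ring
  have e₃ : (ω * stackingPoint - stackingPoint) * (ω * stackingPoint - -stackingPoint) =
      stackingPoint ^ 2 * (-(1 - ω) * (1 + ω)) := by ring
  rw [e₂, zero_add, e₃] at hha
  field_simp at hha
  exact ω_ne_one (by linear_combination -hha)

lemma InKer.not_rotate_one (hUp : ContDiff ℝ (⊤ : ℕ∞) Up) (hUm : ContDiff ℝ (⊤ : ℕ∞) Um)
    (hu : InKer Up Um α 0 u) (hne : u ≠ 0) (hgen : ∀ v, InKer Up Um α 0 v → ∃ c : ℂ, v = c • u)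
    (hrot : ∀ z, u (ω * z) = u z) : False := by
  have h₁₂ := stackingPoint_ne_neg
  have h₁₃ := stackingPoint_ne_ω_mul
  have h₂₃ := neg_stackingPoint_ne_ω_mul
  obtain ⟨c, hc⟩ := hu.meromorphic_multiplier_const hUp hUm hne hgen
    (F := cubicSeries periodPair stackingPoint (-stackingPoint) (ω * stackingPoint))
    (meromorphicAt_cubicSeries h₁₂ h₁₃ h₂₃)
    (fun γ hγ z => cubicSeries_add _ _ _ _ (mem_lattice_iff.2 hγ) z) fun z₀ => by
      by_cases hz₀ : ∀ l : periodPair.lattice, ¬(z₀ - l = stackingPoint ∨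
          z₀ - l = -stackingPoint ∨ z₀ - l = ω * stackingPoint)
      · exact ⟨_, fun z => (u z).1, fun z => (u z).2, analyticAt_cubicSeries hz₀,
          hu.contDiff_fst, hu.contDiff_snd, .of_forall fun z => ⟨rfl, rfl⟩⟩
      · push Not at hz₀
        obtain ⟨l, hl⟩ := hz₀
        have hu0 : u z₀ = 0 := by
          rw [← sub_add_cancel z₀ (l : ℂ)]
          refine hu.eq_zero_add ?_ (mem_lattice_iff.1 l.2)
          rcases hl with h | h | h
          · exact h ▸ hu.eq_zero_stackingPoint hrot
          · exact h ▸ hu.eq_zero_neg_stackingPoint hrot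
          · rw [h, hrot]
            exact hu.eq_zero_stackingPoint hrot
        obtain ⟨w, hw₁, hw₂, hw, -, -⟩ := hu.exists_eq_sub_mul hUp hUm hu0
        obtain ⟨T, hT⟩ := exists_finset_poles periodPair stackingPoint (-stackingPoint)
          (ω * stackingPoint) z₀
        obtain ⟨h, hh, -, e⟩ := cubicSeries_residue_form h₁₂ h₁₃ h₂₃ hT
        refine ⟨h, _, _, hh, hw₁, hw₂, ?_⟩
        filter_upwards [self_mem_nhdsWithin] with z hz
        have hz' : z - z₀ ≠ 0 := sub_ne_zero.2 hz
        rw [hw, e z hz, Prod.smul_fst, Prod.smul_snd, smul_eq_mul, smul_eq_mul]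
        constructor <;> field_simp
  exact cubicSeries_stackingPoint_not_const c (hc _)

end SimplePoles

/-- **Rigidity of simple magic angles.**
If `U` is a tunnelling potential with `conj (U (conj z)) = −U(−z)` and `α` is a simple
magic parameter (`dim Ker(α,k) = 1` for every `k`), then `dim Ker₂(α) = 1`. -/
theorem rigidity_simple (U : ℂ → ℂ) (hU : IsTunnelling U)
    (hsym : ∀ z : ℂ, (starRingEnd ℂ) (U ((starRingEnd ℂ) z)) = -U (-z))
    (α : ℂ) (hα : ∀ k : ℂ, kerDim U (fun z => U (-z)) α k = 1) :
    kerPDim U (fun z => U (-z)) α 2 = 1 := by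
  have hUm : ContDiff ℝ (⊤ : ℕ∞) fun z => U (-z) := hU.1.comp contDiff_neg
  obtain ⟨u, hu, hne, hgen⟩ := exists_generator_of_kerDim_eq_one (hα 0)
  obtain ⟨c, hc, hrot⟩ := hu.exists_eigenvalue hU hne hgen
  have hcω : c = ω := by
    rcases hc with rfl | rfl | rfl
    · exact (hu.not_rotate_one hU.1 hUm hne hgen fun z => by rw [hrot, one_smul]).elim
    · rfl
    · exact (hu.not_rotate_ω_sq hU.1 hUm hne hgen hrot).elim
  have hω : ω ^ (-(2 : ℕ) : ℤ) = ω := by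
    rw [zpow_neg, zpow_natCast]
    exact inv_eq_of_mul_eq_one_left (by linear_combination ω_pow_three)
  have hset : kerPSet U (fun z => U (-z)) α 2 = kerSet U (fun z => U (-z)) α 0 := by
    refine Set.Subset.antisymm (fun v hv => hv.1) fun v hv => ⟨hv, fun z => ?_⟩
    obtain ⟨d, rfl⟩ := hgen v hv
    rw [Pi.smul_apply, Pi.smul_apply, hrot, hω, hcω, smul_comm]
  rw [kerPDim, hset]
  exact hα 0

end TBG
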